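/- arXiv:2110.00767 — 7 statements merged into one kernel-verified Lean document; each statement's English description precedes it below -/
import Mathlib

section
/- Let G be a finite set of indivisible goods, let v₁,…,vₙ be XOS valuations, let (N̄₁,…,N̄ₙ) be a partition of G, and let T := { i ∈ [n] : max_{g∈N̄_i} v_i({g}) ≤ (1/√n)·v_i(N̄_i) }. Let R be a random subset of G obtained by including each good independently with probability 1/2 and R' = G \ R. Then Pr[ v_i(N̄_i ∩ R) ≥ (1/3)·v_i(N̄_i) for all i ∈ T ] ≥ 1 − n·exp(−√n/18), and likewise Pr[ v_i(N̄_i ∩ R') ≥ (1/3)·v_i(N̄_i) for all i ∈ T ] ≥ 1 − n·exp(−√n/18). -/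
/-- A valuation is XOS: the pointwise maximum of a nonempty finite family of
nonnegative additive functions (each given by its per-good values). -/
def IsXOS {G : Type*} (v : Finset G → ℝ) : Prop :=
  ∃ F : Finset (G → ℝ), F.Nonempty ∧ (∀ f ∈ F, ∀ g, 0 ≤ f g) ∧
    ∀ S : Finset G, (∃ f ∈ F, v S = ∑ g ∈ S, f g) ∧ (∀ f ∈ F, ∑ g ∈ S, f g ≤ v S)

/-- An allocation (partition) of the goods `M` among agents `1, …, n`:
pairwise disjoint bundles whose union is `M`. -/
def IsAllocation {G : Type*} [DecidableEq G] {n : ℕ} (M : Finset G)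
    (A : Fin n → Finset G) : Prop :=
  (∀ i j : Fin n, i ≠ j → Disjoint (A i) (A j)) ∧ Finset.univ.biUnion A = M

/- The probability of an event `P` under the uniform distribution on the
subsets of a finite set of goods `G` (equivalently, each good is included
independently with probability `1/2`). -/
open scoped Classical in
noncomputable def prSubsets (G : Type*) [DecidableEq G] [Fintype G]
    (P : Finset G → Prop) : ℝ :=
  (((Finset.univ : Finset (Finset G)).filter P).card : ℝ) / 2 ^ Fintype.card G

lemma sum_exp_signed_sum_le {G : Type*} [DecidableEq G] [Fintype G] (b : G → ℝ) :
    ∑ R : Finset G, Real.exp (∑ g ∈ Rᶜ, b g - ∑ g ∈ R, b g)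
      ≤ 2 ^ Fintype.card G * Real.exp ((∑ g, b g ^ 2) / 2) := by
  have h1 : ∑ R : Finset G, Real.exp (∑ g ∈ Rᶜ, b g - ∑ g ∈ R, b g)
      = ∏ g, (Real.exp (-b g) + Real.exp (b g)) := by
    rw [Finset.prod_add, Finset.powerset_univ]
    refine Finset.sum_congr rfl fun R _ => ?_
    rw [← Real.exp_sum, ← Real.exp_sum, ← Real.exp_add, Finset.sum_neg_distrib,
      ← Finset.compl_eq_univ_sdiff]
    congr 1
    ring
  have h2 : ∏ g, (Real.exp (-b g) + Real.exp (b g))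
      ≤ ∏ g, (2 * Real.exp (b g ^ 2 / 2)) := by
    refine Finset.prod_le_prod (fun g _ => by positivity) fun g _ => ?_
    have := Real.cosh_le_exp_half_sq (b g)
    rw [Real.cosh_eq] at this
    linarith
  rw [h1]
  refine h2.trans_eq ?_
  rw [Finset.prod_mul_distrib, ← Real.exp_sum, Finset.sum_div]
  simp

/-- Hoeffding's inequality for the weight of a uniformly random subset. -/
lemma card_filter_sum_lt_third_le {G : Type*} [DecidableEq G] [Fintype G] (a : G → ℝ)
    (ha : ∀ g, 0 ≤ a g) {s : ℝ} (hs : 0 < s) (hsmall : ∀ g, a g ≤ 1 / s * ∑ g, a g) :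
    ((Finset.univ.filter fun R : Finset G => ∑ g ∈ R, a g < 1 / 3 * ∑ g, a g).card : ℝ)
      ≤ 2 ^ Fintype.card G * Real.exp (-s / 18) := by
  set V := ∑ g, a g with hV
  have hV0 : 0 ≤ V := Finset.sum_nonneg fun g _ => ha g
  rcases hV0.eq_or_lt with h0 | hpos
  · have : (Finset.univ.filter fun R : Finset G => ∑ g ∈ R, a g < 1 / 3 * V) = ∅ := by
      refine Finset.filter_eq_empty_iff.2 fun R _ => ?_
      rw [← h0, mul_zero, not_lt]
      exact Finset.sum_nonneg fun g _ => ha g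
    rw [this, Finset.card_empty, Nat.cast_zero]
    positivity
  have hsq : ∑ g, a g ^ 2 ≤ V ^ 2 / s := by
    calc ∑ g, a g ^ 2 ≤ ∑ g, a g * (1 / s * V) :=
          Finset.sum_le_sum fun g _ => by
            rw [sq]; exact mul_le_mul_of_nonneg_left (hsmall g) (ha g)
      _ = V ^ 2 / s := by rw [← Finset.sum_mul, ← hV]; ring
  set c : ℝ := s / (3 * V) with hc
  have hc0 : 0 < c := by positivity
  have hcV : c * V = s / 3 := by rw [hc]; field_simp
  have key := sum_exp_signed_sum_le fun g => c * a g
  have hexp : (∑ g, (c * a g) ^ 2) / 2 ≤ s / 18 := by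
    calc (∑ g, (c * a g) ^ 2) / 2 = c ^ 2 * (∑ g, a g ^ 2) / 2 := by
          simp_rw [mul_pow, Finset.mul_sum]
      _ ≤ c ^ 2 * (V ^ 2 / s) / 2 := by gcongr
      _ = (c * V) ^ 2 / s / 2 := by ring
      _ = s / 18 := by rw [hcV]; field_simp; norm_num
  have hlow : ((Finset.univ.filter fun R : Finset G => ∑ g ∈ R, a g < 1 / 3 * V).card : ℝ)
      * Real.exp (s / 9) ≤ ∑ R : Finset G,
        Real.exp (∑ g ∈ Rᶜ, c * a g - ∑ g ∈ R, c * a g) := by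
    rw [← nsmul_eq_mul, ← Finset.sum_const]
    refine (Finset.sum_le_sum fun R hR => ?_).trans
      (Finset.sum_le_sum_of_subset_of_nonneg (Finset.filter_subset _ _)
        fun R _ _ => (Real.exp_pos _).le)
    rw [Real.exp_le_exp, ← Finset.mul_sum, ← Finset.mul_sum]
    have hR' := (Finset.mem_filter.1 hR).2
    have hsum := Finset.sum_compl_add_sum R a
    have : c * (1 / 3 * V) ≤ c * (∑ g ∈ Rᶜ, a g - ∑ g ∈ R, a g) :=
      mul_le_mul_of_nonneg_left (by linarith) hc0.le
    linarith
  have hup : 2 ^ Fintype.card G * Real.exp ((∑ g, (c * a g) ^ 2) / 2)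
      ≤ 2 ^ Fintype.card G * Real.exp (-s / 18) * Real.exp (s / 9) := by
    rw [mul_assoc, ← Real.exp_add]
    gcongr
    linarith
  exact le_of_mul_le_mul_right (hlow.trans (key.trans hup)) (Real.exp_pos _)

lemma IsXOS.card_filter_inter_lt_third_le {G : Type*} [DecidableEq G] [Fintype G]
    {v : Finset G → ℝ} (hv : IsXOS v) (N : Finset G) {s : ℝ} (hs : 0 < s)
    (hsmall : ∀ g ∈ N, v {g} ≤ 1 / s * v N) :
    ((Finset.univ.filter fun R : Finset G => v (N ∩ R) < 1 / 3 * v N).card : ℝ)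
      ≤ 2 ^ Fintype.card G * Real.exp (-s / 18) := by
  obtain ⟨F, -, hF0, hF⟩ := hv
  obtain ⟨f, hfF, hfN⟩ := (hF N).1
  have hsum (R : Finset G) : ∑ g ∈ R, (if g ∈ N then f g else 0) = ∑ g ∈ N ∩ R, f g := by
    rw [← Finset.sum_filter, Finset.filter_mem_eq_inter, Finset.inter_comm]
  have htot : ∑ g, (if g ∈ N then f g else 0) = v N := by
    rw [hsum, Finset.inter_univ, hfN]
  have hvN : 0 ≤ v N := hfN ▸ Finset.sum_nonneg fun g _ => hF0 f hfF g
  have key := card_filter_sum_lt_third_le (fun g => if g ∈ N then f g else 0)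
    (fun g => by split_ifs <;> simp [hF0 f hfF g]) hs
    (fun g => by
      simp only [htot]
      split_ifs with hg
      · have := (hF {g}).2 f hfF
        rw [Finset.sum_singleton] at this
        exact this.trans (hsmall g hg)
      · positivity)
  simp only [htot, hsum] at key
  refine le_trans ?_ key
  gcongr with R
  exact (hF _).2 f hfF

lemma prSubsets_compl {G : Type*} [DecidableEq G] [Fintype G] (P : Finset G → Prop) :
    prSubsets G (fun R => P Rᶜ) = prSubsets G P := by
  classical
  unfold prSubsets
  congr 2
  refine Finset.card_bij' (fun R _ => Rᶜ) (fun R _ => Rᶜ) ?_ ?_ ?_ ?_ <;> simp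

/-- Union bound for uniformly random subsets. -/
lemma one_sub_le_prSubsets_forall {G : Type*} [DecidableEq G] [Fintype G] {ι : Type*}
    [Fintype ι] (T : Finset ι) (P : ι → Finset G → Prop) [∀ i, DecidablePred (P i)] {ε : ℝ}
    (hε : 0 ≤ ε)
    (hP : ∀ i ∈ T, ((Finset.univ.filter fun R => ¬ P i R).card : ℝ)
      ≤ 2 ^ Fintype.card G * ε) :
    1 - Fintype.card ι * ε ≤ prSubsets G (fun R => ∀ i ∈ T, P i R) := by
  classical
  have hbad : ((Finset.univ.filter fun R : Finset G => ¬ ∀ i ∈ T, P i R).card : ℝ)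
      ≤ Fintype.card ι * (2 ^ Fintype.card G * ε) := by
    have hsub : (Finset.univ.filter fun R : Finset G => ¬ ∀ i ∈ T, P i R)
        ⊆ T.biUnion fun i => Finset.univ.filter fun R => ¬ P i R := by
      intro R hR
      simpa using hR
    calc ((Finset.univ.filter fun R : Finset G => ¬ ∀ i ∈ T, P i R).card : ℝ)
        ≤ ∑ i ∈ T, ((Finset.univ.filter fun R => ¬ P i R).card : ℝ) := by
          exact_mod_cast (Finset.card_le_card hsub).trans Finset.card_biUnion_le
      _ ≤ ∑ _i ∈ T, 2 ^ Fintype.card G * ε := Finset.sum_le_sum hP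
      _ = T.card * (2 ^ Fintype.card G * ε) := by simp
      _ ≤ _ := by
          gcongr
          exact T.card_le_univ
  have htot := Finset.card_filter_add_card_filter_not (s := (Finset.univ : Finset (Finset G)))
    (fun R => ∀ i ∈ T, P i R)
  rw [Finset.card_univ, Fintype.card_finset] at htot
  have htot' : ((Finset.univ.filter fun R : Finset G => ∀ i ∈ T, P i R).card : ℝ)
      + ((Finset.univ.filter fun R : Finset G => ¬ ∀ i ∈ T, P i R).card : ℝ)
      = 2 ^ Fintype.card G := by exact_mod_cast htot
  unfold prSubsets
  rw [le_div_iff₀ (by positivity)]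
  have hgood : (1 - Fintype.card ι * ε) * 2 ^ Fintype.card G
      ≤ ((Finset.univ.filter fun R : Finset G => ∀ i ∈ T, P i R).card : ℝ) := by linarith
  refine hgood.trans_eq ?_
  congr!

/-- Union bound over the agents of `T` (those whose bundle `N̄_i` contains no good
worth more than `(1/√n)·v_i(N̄_i)`): with probability at least `1 − n·exp(−√n/18)`,
a uniformly random subset `R` (resp. its complement `R' = G \ R`) satisfies
`v_i(N̄_i ∩ R) ≥ (1/3)·v_i(N̄_i)` for all `i ∈ T`. -/
theorem stmt3 {G : Type*} [DecidableEq G] [Fintype G] (n : ℕ) (hn : 1 ≤ n)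
    (v : Fin n → Finset G → ℝ) (hv : ∀ i, IsXOS (v i))
    (Nbar : Fin n → Finset G)
    (hpart : IsAllocation (Finset.univ : Finset G) Nbar)
    (T : Finset (Fin n))
    (hT : ∀ i : Fin n,
      i ∈ T ↔ ∀ g ∈ Nbar i, v i {g} ≤ (1 / Real.sqrt n) * v i (Nbar i)) :
    1 - n * Real.exp (-Real.sqrt n / 18)
        ≤ prSubsets G (fun R => ∀ i ∈ T, (1 / 3) * v i (Nbar i) ≤ v i (Nbar i ∩ R)) ∧
    1 - n * Real.exp (-Real.sqrt n / 18)
        ≤ prSubsets G (fun R => ∀ i ∈ T, (1 / 3) * v i (Nbar i) ≤ v i (Nbar i ∩ Rᶜ)) := by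
  classical
  have hs : 0 < Real.sqrt n := Real.sqrt_pos.2 (by exact_mod_cast hn)
  have key : 1 - n * Real.exp (-Real.sqrt n / 18)
      ≤ prSubsets G (fun R => ∀ i ∈ T, (1 / 3) * v i (Nbar i) ≤ v i (Nbar i ∩ R)) := by
    have := one_sub_le_prSubsets_forall T
      (fun i (R : Finset G) => (1 / 3) * v i (Nbar i) ≤ v i (Nbar i ∩ R))
      (Real.exp_pos (-Real.sqrt n / 18)).le fun i hi => by
        simpa only [not_le] using
          (hv i).card_filter_inter_lt_third_le (Nbar i) hs ((hT i).1 hi)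
    simpa only [Fintype.card_fin] using this
  refine ⟨key, ?_⟩
  rwa [prSubsets_compl fun R => ∀ i ∈ T, (1 / 3) * v i (Nbar i) ≤ v i (Nbar i ∩ R)]
end

section
/- Let n ≥ 1, let v be an XOS valuation on a finite set of goods, and let Y be a set of goods together with an additive witness f for v at Y, i.e., f is an additive function from the defining family of v with f(Y) = v(Y) (so f(T) ≤ v(T) for all T). Let β > 0 satisfy β·v(Y) < 1/√n, define v̂(S) := min{ 1/√n, β·v(S) }, and set prices p_g := 2β·f({g}) for g ∈ Y. Then for every subset X ⊆ Y one has v̂(Y \ X) ≥ v̂(Y) − (1/2)·Σ_{g∈X} p_g. -/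
/-- Bounding the welfare loss from removing a priced subset: if `v` is XOS with
defining family `F`, `f ∈ F` is an additive witness for `v` at `Y`
(`f(Y) = v(Y)`), `β·v(Y) < 1/√n`, the capped valuation is
`v̂(S) = min{1/√n, β·v(S)}`, and the prices are `p_g = 2β·f({g})` for `g ∈ Y`,
then for every `X ⊆ Y` we have `v̂(Y \ X) ≥ v̂(Y) − (1/2)·Σ_{g∈X} p_g`. -/
theorem stmt7 {G : Type*} [DecidableEq G] (n : ℕ) (hn : 1 ≤ n)
    (v : Finset G → ℝ)
    (F : Finset (G → ℝ)) (hF : F.Nonempty)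
    (hFnn : ∀ f ∈ F, ∀ g, 0 ≤ f g)
    (hXOS : ∀ S : Finset G,
      (∃ f ∈ F, v S = ∑ g ∈ S, f g) ∧ (∀ f ∈ F, ∑ g ∈ S, f g ≤ v S))
    (Y : Finset G) (f : G → ℝ) (hfF : f ∈ F)
    (hfwit : ∑ g ∈ Y, f g = v Y)
    (β : ℝ) (hβ : 0 < β) (hcap : β * v Y < 1 / Real.sqrt n)
    (vhat : Finset G → ℝ)
    (hvhat : ∀ S, vhat S = min (1 / Real.sqrt n) (β * v S))
    (p : G → ℝ) (hp : ∀ g, p g = 2 * β * f g) :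
    ∀ X ⊆ Y, vhat Y - (1 / 2) * ∑ g ∈ X, p g ≤ vhat (Y \ X) := by
  intro X hX
  have hsum : (1 / 2) * ∑ g ∈ X, p g = β * ∑ g ∈ X, f g := by
    simp only [hp, ← Finset.mul_sum]
    ring
  have hsplit : ∑ g ∈ Y \ X, f g + ∑ g ∈ X, f g = ∑ g ∈ Y, f g := Finset.sum_sdiff hX
  have hpos : 0 ≤ β * ∑ g ∈ X, f g :=
    mul_nonneg hβ.le (Finset.sum_nonneg fun g _ => hFnn f hfF g)
  have hwit : β * ∑ g ∈ Y \ X, f g ≤ β * v (Y \ X) :=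
    mul_le_mul_of_nonneg_left ((hXOS (Y \ X)).2 f hfF) hβ.le
  have hY : β * v Y = β * ∑ g ∈ Y \ X, f g + β * ∑ g ∈ X, f g := by
    rw [← hfwit, ← hsplit, mul_add]
  rw [hsum, hvhat, hvhat, min_eq_right hcap.le]
  exact le_min (by linarith) (by linarith)
end

section
/- Let n ≥ 1, let R' be a finite set of goods, and for each agent j ∈ [n] let v̂_j : 2^{R'} → ℝ≥0 be monotone with v̂_j(S) ≤ 1/√n for all S. Let (Y₁,…,Yₙ) and (O₁,…,Oₙ) be allocations of R', let Ā ⊆ [n], and let p : R' → ℝ≥0 be nonnegative prices satisfying Σ_{g∈R'} p_g = 2·Σ_{j=1}^n v̂_j(Y_j). Suppose (P1) Σ_{j∈Ā} v̂_j(O_j) ≥ (26/27)·√n and Σ_{j=1}^n v̂_j(Y_j) < (2/25)·Σ_{j∈Ā} v̂_j(O_j). Then there exists an agent a ∈ Ā with v̂_a(Y_a) < 1/(5√n) and v̂_a(O_a) − Σ_{g∈O_a} p_g ≥ 92/(225√n). -/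
/-- If the prices sum to twice the current capped welfare, (P1)
`Σ_{j∈Ā} v̂_j(O_j) ≥ (26/27)·√n` holds, and the current capped welfare is below
`(2/25)·Σ_{j∈Ā} v̂_j(O_j)`, then some agent `a ∈ Ā` has
`v̂_a(Y_a) < 1/(5√n)` and `v̂_a(O_a) − Σ_{g∈O_a} p_g ≥ 92/(225√n)`. -/
theorem stmt8 {G : Type*} [DecidableEq G] (n : ℕ) (hn : 1 ≤ n)
    (R' : Finset G)
    (vhat : Fin n → Finset G → ℝ)
    (hnn : ∀ (j : Fin n) (S : Finset G), 0 ≤ vhat j S)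
    (hmono : ∀ j : Fin n, ∀ ⦃A B : Finset G⦄, A ⊆ B → vhat j A ≤ vhat j B)
    (hub : ∀ (j : Fin n) (S : Finset G), vhat j S ≤ 1 / Real.sqrt n)
    (Y O : Fin n → Finset G)
    (hY : IsAllocation R' Y) (hO : IsAllocation R' O)
    (A : Finset (Fin n))
    (p : G → ℝ) (hpnn : ∀ g, 0 ≤ p g)
    (hpsum : ∑ g ∈ R', p g = 2 * ∑ j, vhat j (Y j))
    (hP1 : (26 / 27) * Real.sqrt n ≤ ∑ j ∈ A, vhat j (O j))
    (hlow : ∑ j, vhat j (Y j) < (2 / 25) * ∑ j ∈ A, vhat j (O j)) :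
    ∃ a ∈ A, vhat a (Y a) < 1 / (5 * Real.sqrt n) ∧
      92 / (225 * Real.sqrt n) ≤ vhat a (O a) - ∑ g ∈ O a, p g := by
  have hn0 : (0 : ℝ) < n := by exact_mod_cast hn
  have hs : 0 < Real.sqrt n := Real.sqrt_pos.mpr hn0
  have hss : (n : ℝ) * (1 / Real.sqrt n) = Real.sqrt n := by
    rw [mul_one_div, Real.div_sqrt]
  have ht : 0 < 1 / Real.sqrt n := by positivity
  have e1 : 1 / (5 * Real.sqrt n) = 1 / 5 * (1 / Real.sqrt n) := by field_simp
  have e2 : 92 / (225 * Real.sqrt n) = 92 / 225 * (1 / Real.sqrt n) := by field_simp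
  rw [e1, e2]
  by_contra! hcon
  have hpoint : ∀ a ∈ A, vhat a (O a) ≤
      92 / 225 * (1 / Real.sqrt n) + 5 * vhat a (Y a) + ∑ g ∈ O a, p g := by
    intro a ha
    have hprice : 0 ≤ ∑ g ∈ O a, p g := Finset.sum_nonneg fun g _ => hpnn g
    rcases lt_or_ge (vhat a (Y a)) (1 / 5 * (1 / Real.sqrt n)) with h | h
    · linarith [hcon a ha h, hnn a (Y a)]
    · linarith [hub a (O a)]
  have hprices : ∑ a, ∑ g ∈ O a, p g = ∑ g ∈ R', p g := by
    rw [← hO.2, Finset.sum_biUnion fun i _ j _ hij => hO.1 i j hij]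
  have hsum : ∑ a ∈ A, vhat a (O a) ≤
      ∑ a, (92 / 225 * (1 / Real.sqrt n) + 5 * vhat a (Y a) + ∑ g ∈ O a, p g) := by
    refine (Finset.sum_le_sum hpoint).trans ?_
    refine Finset.sum_le_sum_of_subset_of_nonneg (Finset.subset_univ A) fun a _ _ => ?_
    have hprice : 0 ≤ ∑ g ∈ O a, p g := Finset.sum_nonneg fun g _ => hpnn g
    linarith [hnn a (Y a)]
  rw [Finset.sum_add_distrib, Finset.sum_add_distrib, hprices, hpsum,
    Finset.sum_const, Finset.card_univ, Fintype.card_fin, nsmul_eq_mul, ← Finset.mul_sum,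
    mul_left_comm, hss] at hsum
  linarith
end

section
/- Let v be an XOS valuation on a finite set G of goods with defining family F of additive functions, let π : G → ℝ be arbitrary prices, and let D ⊆ G be a demand set, i.e., D maximizes v(S) − Σ_{g∈S} π_g over all subsets S ⊆ G. Let f ∈ F be an additive witness for v at D (f(D) = v(D)). Then f({g}) ≥ π_g for every good g ∈ D. -/
/-- For an XOS valuation `v` with defining family `F`, arbitrary prices `π`,
a demand set `D` (maximizing `v(S) − Σ_{g∈S} π_g` over all subsets `S`), and an
additive witness `f ∈ F` for `v` at `D` (`f(D) = v(D)`), every good `g ∈ D`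
satisfies `f({g}) ≥ π_g`. -/
theorem stmt9 {G : Type*} [DecidableEq G]
    (v : Finset G → ℝ)
    (F : Finset (G → ℝ)) (hF : F.Nonempty)
    (hFnn : ∀ f ∈ F, ∀ g, 0 ≤ f g)
    (hXOS : ∀ S : Finset G,
      (∃ f ∈ F, v S = ∑ g ∈ S, f g) ∧ (∀ f ∈ F, ∑ g ∈ S, f g ≤ v S))
    (π : G → ℝ) (D : Finset G)
    (hD : ∀ S : Finset G, v S - ∑ g ∈ S, π g ≤ v D - ∑ g ∈ D, π g)
    (f : G → ℝ) (hfF : f ∈ F) (hfwit : ∑ g ∈ D, f g = v D) :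
    ∀ g ∈ D, π g ≤ f g := by
  intro g hg
  have hwit := (hXOS (D.erase g)).2 f hfF
  have hdem := hD (D.erase g)
  have hf := Finset.add_sum_erase D f hg
  have hπ := Finset.add_sum_erase D π hg
  linarith
end

section
/- Let v₁,…,vₙ be monotone subadditive valuations on a finite set of goods, let M be a finite set of goods with |M| ≥ n, let B₁,…,Bₙ be bundles disjoint from M, and let g*₁,…,g*ₙ be goods. Suppose there exists an injection h : [n] → M with v_i({h(i)}) ≥ v_i({g*_i}) for all i, and let μ : [n] → M be an injection maximizing the product ∏_{i=1}^n v_i(B_i ∪ {μ(i)}) over all injections from [n] into M. Then (∏_{i=1}^n v_i(B_i ∪ {μ(i)}))^{1/n} ≥ (1/2)·(∏_{i=1}^n v_i(B_i ∪ {g*_i}))^{1/n}. -/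
/-- A valuation is nonnegative and monotone. -/
def IsMonotoneVal {G : Type*} (v : Finset G → ℝ) : Prop :=
  (∀ S, 0 ≤ v S) ∧ ∀ ⦃A B : Finset G⦄, A ⊆ B → v A ≤ v B

/-- Rematching guarantee: if `M` admits an injection `h` with
`v_i({h(i)}) ≥ v_i({g*_i})` for all `i`, and `μ` is an injection into `M`
maximizing `∏_i v_i(B_i ∪ {μ(i)})`, then the geometric mean of the values under
`μ` is at least half of that obtained by adjoining the goods `g*_i`. -/
theorem stmt10 {G : Type*} [DecidableEq G] (n : ℕ) (hn : 1 ≤ n)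
    (v : Fin n → Finset G → ℝ)
    (hmono : ∀ i, IsMonotoneVal (v i))
    (hsub : ∀ (i : Fin n) (A B : Finset G), v i (A ∪ B) ≤ v i A + v i B)
    (M : Finset G) (hM : n ≤ M.card)
    (B : Fin n → Finset G) (hBdisj : ∀ i, Disjoint (B i) M)
    (gstar : Fin n → G)
    (h : Fin n → G) (hhinj : Function.Injective h) (hhmem : ∀ i, h i ∈ M)
    (hh : ∀ i, v i {gstar i} ≤ v i {h i})
    (μ : Fin n → G) (hμinj : Function.Injective μ) (hμmem : ∀ i, μ i ∈ M)
    (hμopt : ∀ σ : Fin n → G, Function.Injective σ → (∀ i, σ i ∈ M) →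
      ∏ i, v i (B i ∪ {σ i}) ≤ ∏ i, v i (B i ∪ {μ i})) :
    (1 / 2) * (∏ i, v i (B i ∪ {gstar i})) ^ ((1 : ℝ) / n)
      ≤ (∏ i, v i (B i ∪ {μ i})) ^ ((1 : ℝ) / n) := by
  have hg : ∀ i, v i (B i ∪ {gstar i}) ≤ 2 * v i (B i ∪ {h i}) := fun i => by
    have hB : v i (B i) ≤ v i (B i ∪ {h i}) := (hmono i).2 Finset.subset_union_left
    have hs : v i {h i} ≤ v i (B i ∪ {h i}) := (hmono i).2 Finset.subset_union_right
    linarith [hsub i (B i) {gstar i}, hh i]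
  have hprod : ∏ i, v i (B i ∪ {gstar i}) ≤ 2 ^ n * ∏ i, v i (B i ∪ {μ i}) :=
    calc ∏ i, v i (B i ∪ {gstar i})
        ≤ ∏ i, 2 * v i (B i ∪ {h i}) :=
          Finset.prod_le_prod (fun i _ => (hmono i).1 _) fun i _ => hg i
      _ = 2 ^ n * ∏ i, v i (B i ∪ {h i}) := by simp [Finset.prod_mul_distrib]
      _ ≤ 2 ^ n * ∏ i, v i (B i ∪ {μ i}) := 
          mul_le_mul_of_nonneg_left (hμopt h hhinj hhmem) (by positivity)
  have hroot := Real.rpow_le_rpow (Finset.prod_nonneg fun i _ => (hmono i).1 _) hprod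
    (by positivity : (0 : ℝ) ≤ 1 / n)
  rw [Real.mul_rpow (by positivity) (Finset.prod_nonneg fun i _ => (hmono i).1 _), one_div,
    Real.pow_rpow_inv_natCast (by norm_num) (by omega)] at hroot
  rw [one_div (n : ℝ)]
  linarith
end

section
/- Let n ≥ 2 satisfy 32·log₂ n ≤ √n, let P ⊆ [n] be nonempty, and for each i ∈ P let v_i(g*_i) and v_i(N_i) be nonnegative reals and k_i a positive integer such that Σ_{i∈P} k_i ≤ 2·n·log₂ n and v_i(g*_i) ≥ (1/(16·k_i))·v_i(N_i) for every i ∈ P. Then (∏_{i∈P} v_i(g*_i))^{1/n} ≥ (1/2)·(∏_{i∈P} (v_i(N_i)/√n))^{1/n}. -/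
theorem Real.le_two_rpow_self {x : ℝ} (hx : 0 ≤ x) : x ≤ (2 : ℝ) ^ x := by
  rcases le_total x 1 with h | h
  · exact h.trans (Real.one_le_rpow (by norm_num) hx)
  · have := one_add_mul_self_le_rpow_one_add (s := (1 : ℝ)) (by norm_num) h
    norm_num at this
    linarith

theorem Finset.prod_le_two_rpow_sum {ι : Type*} (s : Finset ι) (x : ι → ℝ)
    (hx : ∀ i ∈ s, 0 ≤ x i) : ∏ i ∈ s, x i ≤ (2 : ℝ) ^ ∑ i ∈ s, x i := by
  rw [Real.rpow_sum_of_pos two_pos]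
  exact Finset.prod_le_prod hx fun i hi => Real.le_two_rpow_self (hx i hi)

/-- If `32·log₂ n ≤ √n`, each `a_i ≥ (1/(16·k_i))·b_i`, and
`Σ_{i∈P} k_i ≤ 2·n·log₂ n`, then
`(∏_{i∈P} a_i)^{1/n} ≥ (1/2)·(∏_{i∈P} (b_i/√n))^{1/n}`.
Here `a_i` plays the role of `v_i(g*_i)` and `b_i` of `v_i(N_i)`. -/
theorem stmt11 (n : ℕ) (hn : 2 ≤ n)
    (hlog : 32 * Real.logb 2 n ≤ Real.sqrt n)
    (P : Finset (Fin n)) (hP : P.Nonempty)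
    (a b : Fin n → ℝ)
    (ha : ∀ i ∈ P, 0 ≤ a i) (hb : ∀ i ∈ P, 0 ≤ b i)
    (k : Fin n → ℕ) (hk : ∀ i ∈ P, 0 < k i)
    (hksum : (∑ i ∈ P, (k i : ℝ)) ≤ 2 * n * Real.logb 2 n)
    (hab : ∀ i ∈ P, (1 / (16 * (k i : ℝ))) * b i ≤ a i) :
    (1 / 2) * (∏ i ∈ P, b i / Real.sqrt n) ^ ((1 : ℝ) / n)
      ≤ (∏ i ∈ P, a i) ^ ((1 : ℝ) / n) := by
  have hn0 : (0 : ℝ) < n := by positivity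
  have hs : 0 < Real.sqrt n := Real.sqrt_pos.2 hn0
  have hprod : ∏ i ∈ P, 16 * (k i : ℝ) / Real.sqrt n ≤ (2 : ℝ) ^ (n : ℝ) := by
    refine (P.prod_le_two_rpow_sum _ fun i _ => by positivity).trans
      (Real.rpow_le_rpow_of_exponent_le one_le_two ?_)
    rw [← Finset.sum_div, ← Finset.mul_sum, div_le_iff₀ hs]
    nlinarith [mul_le_mul_of_nonneg_left hlog hn0.le]
  have hB : 0 ≤ ∏ i ∈ P, b i / Real.sqrt n :=
    Finset.prod_nonneg fun i hi => div_nonneg (hb i hi) hs.le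
  have hA : 0 ≤ ∏ i ∈ P, a i := Finset.prod_nonneg ha
  have hBA : ∏ i ∈ P, b i / Real.sqrt n ≤ (2 : ℝ) ^ (n : ℝ) * ∏ i ∈ P, a i := by
    refine le_trans ?_ (mul_le_mul_of_nonneg_right hprod hA)
    rw [← Finset.prod_mul_distrib]
    refine Finset.prod_le_prod (fun i hi => div_nonneg (hb i hi) hs.le) fun i hi => ?_
    have hki : (0 : ℝ) < k i := Nat.cast_pos.2 (hk i hi)
    have h := hab i hi
    rw [one_div, inv_mul_le_iff₀ (by positivity)] at h
    rw [div_mul_eq_mul_div]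
    gcongr
  have h := Real.rpow_le_rpow hB hBA (by positivity : (0 : ℝ) ≤ 1 / n)
  rw [Real.mul_rpow (by positivity) hA, ← Real.rpow_mul two_pos.le,
    mul_one_div_cancel hn0.ne', Real.rpow_one] at h
  linarith
end

section
/- Let n ≥ 2, let P ⊆ [n] be nonempty, and let (k_i)_{i∈P} be positive integers with Σ_{i∈P} k_i ≤ 2·n·log₂ n. Then ∏_{i∈P} k_i ≤ e^{n/e}·(2·log₂ n)^{|P|}; equivalently, (∏_{i∈P} (1/k_i))^{1/n} ≥ e^{−1/e}·(1/(2·log₂ n))^{|P|/n}. -/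
theorem Real.le_exp_div_exp_one (x : ℝ) : x ≤ Real.exp (x / Real.exp 1) := by
  have h := Real.add_one_le_exp (x / Real.exp 1 - 1)
  rwa [sub_add_cancel, Real.exp_sub, div_le_div_iff_of_pos_right (Real.exp_pos 1)] at h

/-- Nonnegative reals with `∑ x i ≤ M * L` satisfy `∏ x i ≤ exp (M / e) * L ^ #s`. -/
theorem Finset.prod_le_exp_mul_pow_card {ι : Type*} (s : Finset ι) (x : ι → ℝ) {L M : ℝ}
    (hL : 0 < L) (hx : ∀ i ∈ s, 0 ≤ x i) (hsum : ∑ i ∈ s, x i ≤ M * L) :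
    ∏ i ∈ s, x i ≤ Real.exp (M / Real.exp 1) * L ^ s.card := by
  calc ∏ i ∈ s, x i ≤ ∏ i ∈ s, Real.exp (x i / L / Real.exp 1) * L :=
        Finset.prod_le_prod hx fun i _ =>
          (div_le_iff₀ hL).mp (Real.le_exp_div_exp_one (x i / L))
    _ = Real.exp ((∑ i ∈ s, x i) / L / Real.exp 1) * L ^ s.card := by
        rw [Finset.prod_mul_distrib, ← Real.exp_sum, Finset.prod_const, Finset.sum_div,
          Finset.sum_div]
    _ ≤ Real.exp (M / Real.exp 1) * L ^ s.card := by
        have h : (∑ i ∈ s, x i) / L ≤ M := (div_le_iff₀ hL).mpr hsum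
        gcongr

/-- AM–GM bound on the reserved-good counts: if the positive integers `k_i`,
`i ∈ P`, satisfy `Σ_{i∈P} k_i ≤ 2·n·log₂ n`, then
`∏_{i∈P} k_i ≤ e^{n/e}·(2·log₂ n)^{|P|}`; equivalently,
`(∏_{i∈P} 1/k_i)^{1/n} ≥ e^{−1/e}·(1/(2·log₂ n))^{|P|/n}`. -/
theorem stmt12 (n : ℕ) (hn : 2 ≤ n)
    (P : Finset (Fin n)) (hP : P.Nonempty)
    (k : Fin n → ℕ) (hk : ∀ i ∈ P, 0 < k i)
    (hksum : (∑ i ∈ P, (k i : ℝ)) ≤ 2 * n * Real.logb 2 n) :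
    (∏ i ∈ P, (k i : ℝ))
        ≤ Real.exp (n / Real.exp 1) * (2 * Real.logb 2 n) ^ P.card ∧
    Real.exp (-1 / Real.exp 1) * (1 / (2 * Real.logb 2 n)) ^ ((P.card : ℝ) / n)
        ≤ (∏ i ∈ P, 1 / (k i : ℝ)) ^ ((1 : ℝ) / n) := by
  have hn0 : (0 : ℝ) < n := by positivity
  have hL : 0 < 2 * Real.logb 2 n :=
    mul_pos two_pos (Real.logb_pos one_lt_two (by exact_mod_cast hn))
  have hprod : (∏ i ∈ P, (k i : ℝ))
      ≤ Real.exp (n / Real.exp 1) * (2 * Real.logb 2 n) ^ P.card :=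
    P.prod_le_exp_mul_pow_card _ hL (fun i _ => (k i).cast_nonneg) (by linarith)
  refine ⟨hprod, ?_⟩
  have hpos : 0 < ∏ i ∈ P, (k i : ℝ) :=
    Finset.prod_pos fun i hi => by exact_mod_cast hk i hi
  generalize 2 * Real.logb 2 n = L at hL hprod ⊢
  have hroot : Real.exp (-1 / Real.exp 1) * (1 / L) ^ ((P.card : ℝ) / n)
      = (Real.exp (n / Real.exp 1) * L ^ P.card)⁻¹ ^ ((1 : ℝ) / n) := by
    rw [mul_inv, ← Real.exp_neg, ← inv_pow, Real.mul_rpow (Real.exp_pos _).le (by positivity),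
      ← Real.exp_mul, ← Real.rpow_natCast, ← Real.rpow_mul (by positivity), one_div L]
    congr 2 <;> field_simp
  rw [hroot]
  simp only [one_div, Finset.prod_inv_distrib]
  gcongr
end
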